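/- Let n = 2m ≥ 4 be an even integer and c_n = 2^{n-2}((n-2)/2)! π^{n/2}. Suppose the metric e^{2u}|dx|² on ℝⁿ is normal, i.e. u(x) = (1/c_n)∫_{ℝⁿ} log(|y|/|x-y|) f(y) dy + C for some f ∈ L¹(ℝⁿ), and let ū(r) = ⨍_{∂B_r(0)} u dσ denote the spherical average of u. Then for every k > 0, ( ⨍_{∂B_r(0)} e^{ku} dσ ) / e^{k ū(r)} → 1 as r → ∞. -/

import Mathlib

open MeasureTheory Real Filter Metric
open scoped ENNReal Topology

/-- The constant `c_n = 2^(n-2) * ((n-2)/2)! * pi^(n/2)`. -/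
noncomputable def cconst (n : ℕ) : ℝ :=
  2 ^ (n - 2) * (Nat.factorial ((n - 2) / 2)) * Real.pi ^ (n / 2)

/-- The logarithmic potential `v x = (1/c_n) * ∫ log (|x-y|/|y|) f y dy`. -/
noncomputable def logPot (n : ℕ) (f : EuclideanSpace ℝ (Fin n) → ℝ)
    (x : EuclideanSpace ℝ (Fin n)) : ℝ :=
  (1 / cconst n) * ∫ y, Real.log (‖x - y‖ / ‖y‖) * f y

/-- The Laplacian of `f : ℝ^n → ℝ`, as the trace of the second derivative. -/
noncomputable def laplacian {n : ℕ} (f : EuclideanSpace ℝ (Fin n) → ℝ)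
    (x : EuclideanSpace ℝ (Fin n)) : ℝ :=
  ∑ i, iteratedFDeriv ℝ 2 f x ![EuclideanSpace.single i 1, EuclideanSpace.single i 1]

/-- The m-th iterate `(-Δ)^m` of the negative Laplacian. -/
noncomputable def negLapIter {n : ℕ} (m : ℕ) (f : EuclideanSpace ℝ (Fin n) → ℝ) :
    EuclideanSpace ℝ (Fin n) → ℝ :=
  (fun (g : EuclideanSpace ℝ (Fin n) → ℝ) x => -laplacian g x)^[m] f

/-- The surface measure on the unit sphere of `ℝ^n`, obtained from the polar decomposition of
the Lebesgue measure. -/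
noncomputable def sphereMeasure (n : ℕ) :
    MeasureTheory.Measure (Metric.sphere (0 : EuclideanSpace ℝ (Fin n)) 1) :=
  (volume : MeasureTheory.Measure (EuclideanSpace ℝ (Fin n))).toSphere

/-- `ω_{n-1}`, the total surface measure of the unit sphere in `ℝ^n`. -/
noncomputable def omegaN (n : ℕ) : ℝ := (sphereMeasure n Set.univ).toReal

/-- The surface integral `∫_{∂B_s(0)} g dσ`, written in polar coordinates as
`s^{n-1} ∫_{S^{n-1}} g(sθ) dθ`. -/
noncomputable def sphereIntegral (n : ℕ) (g : EuclideanSpace ℝ (Fin n) → ℝ) (s : ℝ) : ℝ :=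
  s ^ (n - 1) * ∫ θ, g (s • (θ : EuclideanSpace ℝ (Fin n))) ∂(sphereMeasure n)

/-- The spherical average `⨍_{∂B_s(0)} g dσ = (1/ω_{n-1}) ∫_{S^{n-1}} g(sθ) dθ`. -/
noncomputable def sphereAvg (n : ℕ) (g : EuclideanSpace ℝ (Fin n) → ℝ) (s : ℝ) : ℝ :=
  (∫ θ, g (s • (θ : EuclideanSpace ℝ (Fin n))) ∂(sphereMeasure n)) / omegaN n

abbrev EE (n : ℕ) := EuclideanSpace ℝ (Fin n)

lemma polar_lint {n : ℕ} (hn : 1 ≤ n) (G : EE n → ℝ≥0∞) (hG : Measurable G) :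
    ∫⁻ θ : Metric.sphere (0 : EE n) 1,
      (∫⁻ ρ in Set.Ioi (0:ℝ), ENNReal.ofReal (ρ ^ (n - 1)) * G (ρ • (θ : EE n)))
      ∂((volume : Measure (EE n)).toSphere) = ∫⁻ x, G x := by
  have : Nonempty (Fin n) := ⟨⟨0, hn⟩⟩
  have h1 := ((volume : Measure (EE n)).measurePreserving_homeomorphUnitSphereProd).lintegral_comp_emb
    (Homeomorph.measurableEmbedding _)
    (fun p : Metric.sphere (0 : EE n) 1 × Set.Ioi (0:ℝ) => G ((p.2 : ℝ) • (p.1 : EE n)))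
  have hmeas : Measurable (fun p : Metric.sphere (0 : EE n) 1 × Set.Ioi (0:ℝ) =>
      G ((p.2 : ℝ) • (p.1 : EE n))) := by
    fun_prop
  rw [lintegral_prod _ hmeas.aemeasurable] at h1
  have h2 : ∀ x : ({0}ᶜ : Set (EE n)), G (((homeomorphUnitSphereProd (EE n) x).2 : ℝ) •
      ((homeomorphUnitSphereProd (EE n) x).1 : EE n)) = G x := by
    intro x
    have : (x : EE n) ≠ 0 := x.2
    have h0 : ‖(x : EE n)‖ ≠ 0 := by simpa using this
    congr 1
    simp only [homeomorphUnitSphereProd_apply_snd_coe, homeomorphUnitSphereProd_apply_fst_coe,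
      smul_smul]
    rw [mul_inv_cancel₀ h0, one_smul]
  simp_rw [h2] at h1
  have h3 : ∫⁻ x : ({0}ᶜ : Set (EE n)), G x ∂((volume : Measure (EE n)).comap (↑)) = ∫⁻ x, G x := by
    rw [lintegral_subtype_comap (measurableSet_singleton _).compl G,
        restrict_compl_singleton]
  rw [← h3, h1]
  refine lintegral_congr fun θ => ?_
  simp only [Measure.volumeIoiPow]
  rw [lintegral_withDensity_eq_lintegral_mul _ (by fun_prop) (by fun_prop)]
  have := lintegral_subtype_comap (μ := (volume : Measure ℝ)) (measurableSet_Ioi (a := (0:ℝ)))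
    (fun ρ => ENNReal.ofReal (ρ ^ (n - 1)) * G (ρ • (θ : EE n)))
  rw [← this]
  simp

noncomputable def KK {n : ℕ} (x y : EE n) : ℝ := Real.log (max ‖x‖ ‖y‖ / ‖x - y‖)

lemma exp_abs_KK_le {n : ℕ} (x y : EE n) :
    Real.exp |KK x y| ≤ 2 + max ‖x‖ ‖y‖ / ‖x - y‖ := by
  unfold KK
  by_cases hxy : x = y
  · subst hxy; simp
  have hd : 0 < ‖x - y‖ := norm_pos_iff.2 (sub_ne_zero.2 hxy)
  have hle : ‖x - y‖ ≤ 2 * max ‖x‖ ‖y‖ := by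
    have := norm_sub_le x y
    have h1 := le_max_left ‖x‖ ‖y‖
    have h2 := le_max_right ‖x‖ ‖y‖
    linarith
  have hN : 0 < max ‖x‖ ‖y‖ := by linarith
  have ht : 0 < max ‖x‖ ‖y‖ / ‖x - y‖ := by positivity
  rcases abs_cases (Real.log (max ‖x‖ ‖y‖ / ‖x - y‖)) with h | h
  · rw [h.1, Real.exp_log ht]; linarith
  · rw [h.1, Real.exp_neg, Real.exp_log ht, inv_div]
    have : ‖x - y‖ / max ‖x‖ ‖y‖ ≤ 2 := by rw [div_le_iff₀ hN]; exact hle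
    linarith

noncomputable def GG {n : ℕ} (x : EE n) : ℝ≥0∞ :=
  (ball (0 : EE n) 7).indicator (fun x => ENNReal.ofReal ((‖x‖ ^ 2)⁻¹)) x

lemma GG_meas {n : ℕ} : Measurable (GG (n := n)) := by
  unfold GG
  refine Measurable.indicator ?_ measurableSet_ball
  fun_prop

lemma GG_fin {n : ℕ} (hn : 4 ≤ n) : ∫⁻ x, GG (n := n) x ≠ ∞ := by
  unfold GG
  rw [lintegral_indicator measurableSet_ball]
  have hi : IntegrableOn (fun x : EE n => (‖x‖ ^ 2)⁻¹) (ball 0 7) := by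
    refine integrableOn_ball_of_norm_le_rpow (C := 1) (α := 2) (by simp; omega) ?_ ?_ ?_
    · simp; exact_mod_cast (by omega : 2 < n)
    · refine Eventually.of_forall fun x => ?_
      rw [Real.norm_of_nonneg (by positivity), one_mul, Real.rpow_neg (norm_nonneg _)]
      simp
    · exact (by fun_prop : Measurable (fun x : EE n => (‖x‖ ^ 2)⁻¹)).aestronglyMeasurable
  exact (hi.lintegral_lt_top).ne

lemma radial_lower {n : ℕ} (θ : Metric.sphere (0 : EE n) 1) (r : ℝ) (hr : 0 < r) (y : EE n) :
    ENNReal.ofReal (max ‖r • (θ : EE n)‖ ‖y‖ / ‖r • (θ : EE n) - y‖) ≤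
      9 * ∫⁻ ρ in Set.Ioi (0:ℝ), ENNReal.ofReal (ρ ^ (n - 1)) *
        GG (ρ • (θ : EE n) - (max r ‖y‖)⁻¹ • y) := by
  have hθ : ‖(θ : EE n)‖ = 1 := by simp
  have hx : ‖r • (θ : EE n)‖ = r := by rw [norm_smul, hθ, Real.norm_of_nonneg hr.le, mul_one]
  rw [hx]
  set N := max r ‖y‖ with hNdef
  have hN : 0 < N := lt_max_of_lt_left hr
  set z := N⁻¹ • y with hz
  set D := ‖r • (θ : EE n) - y‖ / N with hD
  have hD0 : 0 ≤ D := by positivity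
  have hinv : N / ‖r • (θ : EE n) - y‖ = D⁻¹ := by rw [hD, inv_div]
  rw [hinv]
  rcases hD0.eq_or_lt with h0 | hDpos
  · rw [← h0]; simp
  have hzn : ‖z‖ ≤ 1 := by
    rw [hz, norm_smul, Real.norm_of_nonneg (by positivity), inv_mul_le_iff₀ hN, mul_one]
    exact le_max_right _ _
  have hNDr : N - r ≤ ‖r • (θ : EE n) - y‖ := by
    rcases max_cases r ‖y‖ with h | h
    · rw [hNdef, h.1, sub_self]; positivity
    · rw [hNdef, h.1]
      have := norm_sub_norm_le y (r • (θ : EE n))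
      rw [hx, norm_sub_rev] at this
      exact this
  have hrN : r ≤ N := le_max_left _ _
  have hD2 : D ≤ 2 := by
    rw [hD, div_le_iff₀ hN]
    have := norm_sub_le (r • (θ : EE n)) y
    rw [hx] at this
    have h2 : ‖y‖ ≤ N := le_max_right _ _
    linarith
  have hθz : ‖(θ : EE n) - z‖ ≤ 2 * D := by
    have e1 : N • ((θ : EE n) - z) = (N - r) • (θ : EE n) + (r • (θ : EE n) - y) := by
      rw [hz, smul_sub, smul_smul, mul_inv_cancel₀ hN.ne', one_smul, sub_smul]; abel
    have e2 : N * ‖(θ : EE n) - z‖ ≤ 2 * ‖r • (θ : EE n) - y‖ := by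
      calc N * ‖(θ : EE n) - z‖ = ‖N • ((θ : EE n) - z)‖ := by
            rw [norm_smul, Real.norm_of_nonneg hN.le]
        _ ≤ ‖(N - r) • (θ : EE n)‖ + ‖r • (θ : EE n) - y‖ := by rw [e1]; exact norm_add_le _ _
        _ = (N - r) + ‖r • (θ : EE n) - y‖ := by
            rw [norm_smul, hθ, Real.norm_of_nonneg (by linarith), mul_one]
        _ ≤ _ := by linarith
    rw [hD, ← mul_div_assoc, le_div_iff₀ hN]
    linarith
  have key : ∀ ρ ∈ Set.Ioo 1 (1 + D), ENNReal.ofReal ((9 * D ^ 2)⁻¹) ≤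
      ENNReal.ofReal (ρ ^ (n - 1)) * GG (ρ • (θ : EE n) - z) := by
    intro ρ hρ
    have a1 : ‖ρ • (θ : EE n) - z‖ ≤ 3 * D := by
      have : ρ • (θ : EE n) - z = (ρ - 1) • (θ : EE n) + ((θ : EE n) - z) := by
        rw [sub_smul, one_smul]; abel
      rw [this]
      refine (norm_add_le _ _).trans ?_
      rw [norm_smul, hθ, Real.norm_of_nonneg (by linarith [hρ.1])]
      linarith [hρ.2]
    have a2 : 0 < ‖ρ • (θ : EE n) - z‖ := by
      have := norm_sub_norm_le (ρ • (θ : EE n)) z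
      rw [norm_smul, hθ, Real.norm_of_nonneg (by linarith [hρ.1])] at this
      linarith [hρ.1]
    have hmem : ρ • (θ : EE n) - z ∈ ball (0 : EE n) 7 := by
      rw [mem_ball_zero_iff]; linarith
    unfold GG
    rw [Set.indicator_of_mem hmem, ← ENNReal.ofReal_mul (by have := hρ.1; positivity)]
    apply ENNReal.ofReal_le_ofReal
    have a3 : (1:ℝ) ≤ ρ ^ (n - 1) := one_le_pow₀ hρ.1.le
    have a4 : (9 * D ^ 2)⁻¹ ≤ (‖ρ • (θ : EE n) - z‖ ^ 2)⁻¹ := by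
      apply inv_anti₀ (by positivity)
      nlinarith
    have a5 : 0 ≤ (‖ρ • (θ : EE n) - z‖ ^ 2)⁻¹ := by positivity
    nlinarith
  calc ENNReal.ofReal D⁻¹
      = 9 * (ENNReal.ofReal ((9 * D ^ 2)⁻¹) * ENNReal.ofReal D) := by
        rw [← ENNReal.ofReal_mul (by positivity), show (9 : ℝ≥0∞) = ENNReal.ofReal 9 by simp,
          ← ENNReal.ofReal_mul (by positivity)]
        congr 1
        field_simp
    _ = 9 * ∫⁻ ρ in Set.Ioo 1 (1 + D), ENNReal.ofReal ((9 * D ^ 2)⁻¹) := by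
        rw [setLIntegral_const, Real.volume_Ioo, add_sub_cancel_left]
    _ ≤ 9 * ∫⁻ ρ in Set.Ioo 1 (1 + D), ENNReal.ofReal (ρ ^ (n - 1)) *
        GG (ρ • (θ : EE n) - z) := by
        gcongr 9 * ?_
        exact setLIntegral_mono' measurableSet_Ioo key
    _ ≤ _ := by
        gcongr 9 * ?_
        refine lintegral_mono_set ?_
        intro ρ hρ
        exact lt_trans one_pos hρ.1

lemma sphere_bound {n : ℕ} (hn : 4 ≤ n) : ∃ M : ℝ, 0 ≤ M ∧ ∀ r > (0:ℝ), ∀ y : EE n,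
    ∫⁻ θ : Metric.sphere (0 : EE n) 1, ENNReal.ofReal (Real.exp |KK (r • (θ : EE n)) y|)
      ∂((volume : Measure (EE n)).toSphere) ≤ ENNReal.ofReal M := by
  set B : ℝ≥0∞ := 2 * (volume : Measure (EE n)).toSphere Set.univ + 9 * ∫⁻ x, GG (n := n) x with hB
  have hBfin : B ≠ ∞ := by
    rw [hB]
    exact ENNReal.add_ne_top.2 ⟨ENNReal.mul_ne_top (by simp) (measure_ne_top _ _),
      ENNReal.mul_ne_top (by simp) (GG_fin hn)⟩
  refine ⟨B.toReal, ENNReal.toReal_nonneg, fun r hr y => ?_⟩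
  rw [ENNReal.ofReal_toReal hBfin]
  set z : EE n := (max r ‖y‖)⁻¹ • y
  calc ∫⁻ θ : Metric.sphere (0 : EE n) 1, ENNReal.ofReal (Real.exp |KK (r • (θ : EE n)) y|)
      ∂((volume : Measure (EE n)).toSphere)
      ≤ ∫⁻ θ : Metric.sphere (0 : EE n) 1, (2 + 9 * ∫⁻ ρ in Set.Ioi (0:ℝ),
        ENNReal.ofReal (ρ ^ (n - 1)) * GG (ρ • (θ : EE n) - z))
          ∂((volume : Measure (EE n)).toSphere) := by
        refine lintegral_mono fun θ => ?_
        refine (ENNReal.ofReal_le_ofReal (exp_abs_KK_le _ _)).trans ?_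
        rw [ENNReal.ofReal_add (by norm_num) (by positivity)]
        gcongr
        · simp
        · exact radial_lower θ r hr y
    _ = 2 * (volume : Measure (EE n)).toSphere Set.univ + 9 * ∫⁻ x, GG (n := n) (x - z) := by
        rw [lintegral_add_left measurable_const, lintegral_const, lintegral_const_mul' _ _ (by simp)]
        have := polar_lint (n := n) (by omega) (fun x => GG (x - z))
          (GG_meas.comp (measurable_id.sub_const z))
        rw [this]
    _ = B := by rw [lintegral_sub_right_eq_self (fun x => GG (n := n) x) z]

lemma exp_tangent {α : Type*} [MeasurableSpace α] (μ : Measure α) (φ g : α → ℝ)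
    (hφ0 : ∀ x, 0 ≤ φ x) (hφ : Integrable φ μ) (hm : ∫ x, φ x ∂μ ≤ 1)
    (hg : Integrable (fun x => φ x * g x) μ)
    (he : Integrable (fun x => φ x * Real.exp (g x)) μ) :
    Real.exp (∫ x, φ x * g x ∂μ) ≤ 1 + ∫ x, φ x * Real.exp (g x) ∂μ := by
  set c := ∫ x, φ x * g x ∂μ with hc
  set m := ∫ x, φ x ∂μ with hmd
  have hm0 : 0 ≤ m := integral_nonneg hφ0
  have h1 : Real.exp c * (m * (1 - c) + c) ≤ ∫ x, φ x * Real.exp (g x) ∂μ := by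
    have : Real.exp c * (m * (1 - c) + c) =
        ∫ x, Real.exp c * (φ x * (1 - c) + φ x * g x) ∂μ := by
      rw [integral_const_mul, integral_add (hφ.mul_const _) hg, integral_mul_const]
    rw [this]
    refine integral_mono (((hφ.mul_const _).add hg).const_mul _) he fun x => ?_
    have h2 : Real.exp (g x) = Real.exp c * Real.exp (g x - c) := by
      rw [← Real.exp_add]; congr 1; ring
    have h3 := Real.add_one_le_exp (g x - c)
    have h4 : 0 ≤ φ x * Real.exp c := mul_nonneg (hφ0 x) (Real.exp_pos c).le
    simp only [h2]
    nlinarith [mul_le_mul_of_nonneg_left h3 h4]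
  have h5 : Real.exp c * (1 - c) ≤ 1 := by
    have := Real.add_one_le_exp (-c)
    calc Real.exp c * (1 - c) ≤ Real.exp c * Real.exp (-c) := by
          gcongr; linarith
      _ = 1 := by rw [← Real.exp_add]; simp
  have h6 : Real.exp c - Real.exp c * (m * (1 - c) + c) = (1 - m) * (Real.exp c * (1 - c)) := by
    ring
  have h7 : (1 - m) * (Real.exp c * (1 - c)) ≤ 1 := by
    nlinarith
  linarith

lemma KK_meas {n : ℕ} (r : ℝ) :
    Measurable (fun p : Metric.sphere (0 : EE n) 1 × EE n => KK (r • (p.1 : EE n)) p.2) := by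
  unfold KK
  fun_prop

lemma tonelli_bound {n : ℕ} {M : ℝ} (hM : ∀ r > (0:ℝ), ∀ y : EE n,
    ∫⁻ θ : Metric.sphere (0 : EE n) 1, ENNReal.ofReal (Real.exp |KK (r • (θ : EE n)) y|)
      ∂((volume : Measure (EE n)).toSphere) ≤ ENNReal.ofReal M)
    (f : EE n → ℝ) (hfm : Measurable f) (hf : Integrable f) (r : ℝ) (hr : 0 < r) (S : Set (EE n)) :
    ∫⁻ θ : Metric.sphere (0 : EE n) 1, (∫⁻ y in S, ENNReal.ofReal
      (|f y| * Real.exp |KK (r • (θ : EE n)) y|)) ∂((volume : Measure (EE n)).toSphere)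
      ≤ ENNReal.ofReal ((∫ y in S, |f y|) * M) := by
  have hK := KK_meas (n := n) r
  rw [lintegral_lintegral_swap]
  · calc ∫⁻ y in S, (∫⁻ θ : Metric.sphere (0 : EE n) 1,
            ENNReal.ofReal (|f y| * Real.exp |KK (r • (θ : EE n)) y|)
            ∂((volume : Measure (EE n)).toSphere))
        ≤ ∫⁻ y in S, ENNReal.ofReal |f y| * ENNReal.ofReal M := by
          refine lintegral_mono fun y => ?_
          simp_rw [ENNReal.ofReal_mul (abs_nonneg (f y))]
          rw [lintegral_const_mul' _ _ (by simp)]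
          gcongr
          exact hM r hr y
      _ = ENNReal.ofReal ((∫ y in S, |f y|) * M) := by
          rw [lintegral_mul_const' _ _ (by simp), ENNReal.ofReal_mul (integral_nonneg fun _ => abs_nonneg _),
            ofReal_integral_eq_lintegral_ofReal hf.abs.integrableOn
              (Eventually.of_forall fun _ => abs_nonneg _)]
  · refine Measurable.aemeasurable ?_
    have h2 : Measurable (fun p : Metric.sphere (0 : EE n) 1 × EE n => |KK (r • (p.1 : EE n)) p.2|) :=
      continuous_abs.measurable.comp hK
    have h3 : Measurable (fun p : Metric.sphere (0 : EE n) 1 × EE n => |f p.2|) :=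
      continuous_abs.measurable.comp (hfm.comp measurable_snd)
    exact (h3.mul (Real.measurable_exp.comp h2)).ennreal_ofReal

lemma ae_integrable {n : ℕ} {M : ℝ} (hM : ∀ r > (0:ℝ), ∀ y : EE n,
    ∫⁻ θ : Metric.sphere (0 : EE n) 1, ENNReal.ofReal (Real.exp |KK (r • (θ : EE n)) y|)
      ∂((volume : Measure (EE n)).toSphere) ≤ ENNReal.ofReal M)
    (f : EE n → ℝ) (hfm : Measurable f) (hf : Integrable f) (r : ℝ) (hr : 0 < r) :
    ∀ᵐ θ : Metric.sphere (0 : EE n) 1 ∂((volume : Measure (EE n)).toSphere),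
      Integrable (fun y => |f y| * Real.exp |KK (r • (θ : EE n)) y|) ∧
      Integrable (fun y => |f y| * |KK (r • (θ : EE n)) y|) := by
  have hK := KK_meas (n := n) r
  have h2 : Measurable (fun p : Metric.sphere (0 : EE n) 1 × EE n => |KK (r • (p.1 : EE n)) p.2|) :=
    continuous_abs.measurable.comp hK
  have h3 : Measurable (fun p : Metric.sphere (0 : EE n) 1 × EE n => |f p.2|) :=
    continuous_abs.measurable.comp (hfm.comp measurable_snd)
  have hmm := (h3.mul (Real.measurable_exp.comp h2))
  have hb := tonelli_bound hM f hfm hf r hr Set.univ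
  simp only [Measure.restrict_univ] at hb
  have hlt := ae_lt_top' (μ := (volume : Measure (EE n)).toSphere)
    (hmm.ennreal_ofReal.lintegral_prod_right' (ν := (volume : Measure (EE n)))).aemeasurable
    (lt_of_le_of_lt hb ENNReal.ofReal_lt_top).ne
  filter_upwards [hlt] with θ hθ
  have i1 : Integrable (fun y => |f y| * Real.exp |KK (r • (θ : EE n)) y|) := by
    refine ⟨(hmm.comp measurable_prodMk_left).aestronglyMeasurable, ?_⟩
    rw [hasFiniteIntegral_iff_ofReal (Eventually.of_forall fun y => by positivity)]
    exact hθ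
  refine ⟨i1, i1.mono ((h3.mul h2).comp measurable_prodMk_left).aestronglyMeasurable ?_⟩
  refine Eventually.of_forall fun y => ?_
  rw [Real.norm_of_nonneg (by positivity), Real.norm_of_nonneg (by positivity)]
  gcongr
  linarith [Real.add_one_le_exp |KK (r • (θ : EE n)) y|]

lemma tail_small {n : ℕ} (f : EE n → ℝ) (hf : Integrable f) (ε : ℝ) (hε : 0 < ε) :
    ∃ R : ℝ, 0 < R ∧ ∫ y in (closedBall (0 : EE n) R)ᶜ, |f y| < ε := by
  have h := tendsto_setIntegral_of_antitone (μ := (volume : Measure (EE n))) (f := fun y => |f y|)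
    (s := fun R : ℝ => (closedBall (0 : EE n) R)ᶜ) (fun R => measurableSet_closedBall.compl)
    (fun a b hab => Set.compl_subset_compl.2 (closedBall_subset_closedBall hab))
    ⟨0, hf.abs.integrableOn⟩
  have he : (⋂ R : ℝ, (closedBall (0 : EE n) R)ᶜ) = ∅ := by
    ext x
    simp only [Set.mem_iInter, Set.mem_compl_iff, Set.mem_empty_iff_false, iff_false, not_forall,
      not_not]
    exact ⟨‖x‖, by simp⟩
  rw [he] at h
  simp only [Measure.restrict_empty, integral_zero_measure] at h
  obtain ⟨R, h1, h2⟩ := ((h.eventually (gt_mem_nhds hε)).and (eventually_gt_atTop 0)).exists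
  exact ⟨R, h2, h1⟩

lemma KK_small {n : ℕ} (R δ : ℝ) (hR : 0 < R) (hδ : 0 < δ) : ∀ᶠ r : ℝ in atTop,
    ∀ θ : Metric.sphere (0 : EE n) 1, ∀ y ∈ closedBall (0 : EE n) R,
      |KK (r • (θ : EE n)) y| ≤ δ := by
  have hc : ContinuousAt Real.log 1 := Real.continuousAt_log one_ne_zero
  rw [Metric.continuousAt_iff] at hc
  obtain ⟨η, hη, h⟩ := hc δ hδ
  filter_upwards [eventually_gt_atTop (R / η), eventually_gt_atTop R] with r h1 h2 θ y hy
  have hr : 0 < r := hR.trans h2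
  have hy' : ‖y‖ ≤ R := by simpa using hy
  have hx : ‖r • (θ : EE n)‖ = r := by simp [norm_smul, abs_of_pos hr]
  unfold KK
  rw [hx, max_eq_left (by linarith), ← inv_div, Real.log_inv, abs_neg]
  have h3 : dist (‖r • (θ : EE n) - y‖ / r) 1 < η := by
    rw [Real.dist_eq, div_sub_one hr.ne', abs_div, abs_of_pos hr, div_lt_iff₀ hr]
    have := abs_norm_sub_norm_le (r • (θ : EE n) - y) (r • (θ : EE n))
    rw [hx] at this
    rw [div_lt_iff₀ hη] at h1
    have e : r • (θ : EE n) - y - r • (θ : EE n) = -y := by abel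
    rw [e, norm_neg] at this
    linarith
  have := h h3
  rw [Real.dist_eq, Real.log_one, sub_zero] at this
  exact this.le

lemma W_bound {n : ℕ} (hn : 4 ≤ n) (f : EE n → ℝ) (hfm : Measurable f) (hf : Integrable f)
    (κ : ℝ) (hκ : 0 < κ) (δ : ℝ) (hδ : 0 < δ) :
    ∀ᶠ r : ℝ in atTop,
      ∫⁻ θ : Metric.sphere (0 : EE n) 1,
        ENNReal.ofReal (Real.exp (κ * ∫ y, |f y| * |KK (r • (θ : EE n)) y|))
        ∂((volume : Measure (EE n)).toSphere) ≤
      ENNReal.ofReal ((1 + δ) * (volume : Measure (EE n)).toSphere.real Set.univ) := by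
  have : Nonempty (Fin n) := ⟨⟨0, by omega⟩⟩
  obtain ⟨M, hM0, hM⟩ := sphere_bound hn
  set ω := (volume : Measure (EE n)).toSphere.real Set.univ with hω
  have hωpos : 0 < ω := by
    rw [hω, measureReal_def]
    refine ENNReal.toReal_pos ?_ (measure_ne_top _ _)
    rw [ne_eq, Measure.measure_univ_eq_zero]
    exact Measure.toSphere_ne_zero _
  obtain ⟨q, hq, hq1⟩ : ∃ q : ℝ, 0 < q ∧ Real.exp q * (1 + q) ≤ 1 + δ := by
    have hc : ContinuousAt (fun q : ℝ => Real.exp q * (1 + q)) 0 := by fun_prop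
    have h1 : ∀ᶠ q in 𝓝 (0:ℝ), Real.exp q * (1 + q) < 1 + δ :=
      hc.eventually (gt_mem_nhds (by simpa using hδ))
    obtain ⟨q, hq1, hq⟩ := ((h1.filter_mono nhdsWithin_le_nhds).and
      (self_mem_nhdsWithin (s := Set.Ioi (0:ℝ)))).exists
    exact ⟨q, hq, hq1.le⟩
  set I := ∫ y, |f y| with hI
  have hI0 : 0 ≤ I := integral_nonneg fun _ => abs_nonneg _
  obtain ⟨R, hR, hRε⟩ := tail_small f hf (min (1 / κ) (q * ω / (κ * (M + 1)))) (by positivity)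
  set ε := ∫ y in (closedBall (0 : EE n) R)ᶜ, |f y| with hε
  have hε0 : 0 ≤ ε := integral_nonneg fun _ => abs_nonneg _
  have hε1 : κ * ε ≤ 1 := by
    have := (lt_min_iff.1 hRε).1
    rw [lt_div_iff₀ hκ] at this
    linarith
  have hε2 : κ * (ε * M) ≤ q * ω := by
    have := (lt_min_iff.1 hRε).2
    rw [lt_div_iff₀ (by positivity)] at this
    nlinarith [mul_nonneg hκ.le hε0]
  set δ1 := q / (κ * I + 1) with hδ1
  have hδ1pos : 0 < δ1 := by positivity
  have hδ1q : κ * (δ1 * I) ≤ q := by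
    have : κ * (δ1 * I) = q * (κ * I / (κ * I + 1)) := by rw [hδ1]; ring
    rw [this]
    have h2 : κ * I / (κ * I + 1) ≤ 1 := by
      rw [div_le_one (by positivity)]; linarith
    nlinarith
  filter_upwards [KK_small (n := n) R δ1 hR hδ1pos, eventually_gt_atTop 0] with r hsm hr
  have hae := ae_integrable hM f hfm hf r hr
  have hpt : ∀ᵐ θ : Metric.sphere (0 : EE n) 1 ∂((volume : Measure (EE n)).toSphere),
      ENNReal.ofReal (Real.exp (κ * ∫ y, |f y| * |KK (r • (θ : EE n)) y|)) ≤
      ENNReal.ofReal (Real.exp q) * (1 + ENNReal.ofReal κ *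
        ∫⁻ y in (closedBall (0 : EE n) R)ᶜ, ENNReal.ofReal
          (|f y| * Real.exp |KK (r • (θ : EE n)) y|)) := by
    filter_upwards [hae] with θ hθ
    obtain ⟨i1, i2⟩ := hθ
    have hsplit := integral_add_compl (measurableSet_closedBall (x := (0 : EE n)) (ε := R)) i2
    have hin : ∫ y in closedBall (0 : EE n) R, |f y| * |KK (r • (θ : EE n)) y| ≤ δ1 * I := by
      calc ∫ y in closedBall (0 : EE n) R, |f y| * |KK (r • (θ : EE n)) y|
          ≤ ∫ y in closedBall (0 : EE n) R, |f y| * δ1 := by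
            refine setIntegral_mono_on i2.integrableOn (hf.abs.mul_const _).integrableOn
              measurableSet_closedBall fun y hy => ?_
            gcongr
            exact hsm θ y hy
        _ ≤ ∫ y, |f y| * δ1 :=
            setIntegral_le_integral (hf.abs.mul_const _)
              (Eventually.of_forall fun y => by positivity)
        _ = δ1 * I := by rw [integral_mul_const, mul_comm]
    have htan := exp_tangent (volume.restrict (closedBall (0 : EE n) R)ᶜ) (fun y => κ * |f y|)
      (fun y => |KK (r • (θ : EE n)) y|) (fun y => by positivity)
      (hf.abs.const_mul κ).integrableOn (by rw [integral_const_mul]; exact hε1)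
      (by simp_rw [mul_assoc]; exact (i2.const_mul κ).integrableOn)
      (by simp_rw [mul_assoc]; exact (i1.const_mul κ).integrableOn)
    simp_rw [mul_assoc, integral_const_mul] at htan
    have e1 : ∫⁻ y in (closedBall (0 : EE n) R)ᶜ, ENNReal.ofReal
          (|f y| * Real.exp |KK (r • (θ : EE n)) y|) = ENNReal.ofReal
          (∫ y in (closedBall (0 : EE n) R)ᶜ, |f y| * Real.exp |KK (r • (θ : EE n)) y|) := by
      rw [ofReal_integral_eq_lintegral_ofReal i1.integrableOn
        (Eventually.of_forall fun y => by positivity)]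
    have e2 : 0 ≤ ∫ y in (closedBall (0 : EE n) R)ᶜ, |f y| * Real.exp |KK (r • (θ : EE n)) y| :=
      integral_nonneg fun y => by positivity
    rw [e1, ← ENNReal.ofReal_mul hκ.le, ← ENNReal.ofReal_one,
      ← ENNReal.ofReal_add zero_le_one (by positivity), ← ENNReal.ofReal_mul (by positivity)]
    apply ENNReal.ofReal_le_ofReal
    rw [← hsplit, mul_add, Real.exp_add]
    gcongr
    exact (mul_le_mul_of_nonneg_left hin hκ.le).trans hδ1q
  have hω' : (volume : Measure (EE n)).toSphere Set.univ = ENNReal.ofReal ω := by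
    rw [hω, measureReal_def, ENNReal.ofReal_toReal (measure_ne_top _ _)]
  refine (lintegral_mono_ae hpt).trans ?_
  rw [lintegral_const_mul' _ _ (by simp), lintegral_add_left measurable_const, lintegral_const,
    lintegral_const_mul' _ _ (by simp), hω', one_mul]
  calc ENNReal.ofReal (Real.exp q) * (ENNReal.ofReal ω + ENNReal.ofReal κ * _)
      ≤ ENNReal.ofReal (Real.exp q) * (ENNReal.ofReal ω + ENNReal.ofReal κ *
        ENNReal.ofReal (ε * M)) := by
        gcongr
        exact tonelli_bound hM f hfm hf r hr _
    _ = ENNReal.ofReal (Real.exp q * (ω + κ * (ε * M))) := by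
        rw [← ENNReal.ofReal_mul hκ.le, ← ENNReal.ofReal_add hωpos.le (by positivity),
          ← ENNReal.ofReal_mul (by positivity)]
    _ ≤ _ := by
        apply ENNReal.ofReal_le_ofReal
        calc Real.exp q * (ω + κ * (ε * M)) ≤ Real.exp q * (ω + q * ω) := by gcongr
          _ = Real.exp q * (1 + q) * ω := by ring
          _ ≤ (1 + δ) * ω := by gcongr

lemma abs_exp_sub_one_le_aux (s : ℝ) : |Real.exp s - 1| ≤ Real.exp |s| - 1 := by
  have h1 := Real.add_one_le_exp s
  have h2 := Real.add_one_le_exp (-s)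
  rcases abs_cases s with h | h
  · rw [h.1, abs_of_nonneg (by linarith)]
  · have h3 : Real.exp s ≤ 1 := Real.exp_le_one_iff.2 h.2.le
    rw [h.1, abs_of_nonpos (by linarith)]
    linarith

lemma rep {n : ℕ} (hn : 4 ≤ n) (f : EE n → ℝ) (hfm : Measurable f) (hf : Integrable f)
    (a C : ℝ) (ha : 0 < a) (r : ℝ) (hr : 0 < r) :
    ∃ h : ℝ, ∀ᵐ θ : Metric.sphere (0 : EE n) 1 ∂((volume : Measure (EE n)).toSphere),
      |(a * (∫ y, Real.log (‖y‖ / ‖r • (θ : EE n) - y‖) * f y) + C) - h| ≤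
        a * ∫ y, |f y| * |KK (r • (θ : EE n)) y| := by
  have : Nonempty (Fin n) := ⟨⟨0, by omega⟩⟩
  obtain ⟨M, hM0, hM⟩ := sphere_bound hn
  have hae := ae_integrable hM f hfm hf r hr
  have hpt : ∀ θ : Metric.sphere (0 : EE n) 1,
      (fun y => Real.log (‖y‖ / ‖r • (θ : EE n) - y‖) * f y) =ᵐ[volume]
      (fun y => Real.log (‖y‖ / max r ‖y‖) * f y + KK (r • (θ : EE n)) y * f y) := by
    intro θ
    have h1 : ∀ᵐ y : EE n, y ≠ 0 := by simp [ae_iff, measure_singleton]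
    have h2 : ∀ᵐ y : EE n, y ≠ r • (θ : EE n) := by simp [ae_iff, measure_singleton]
    filter_upwards [h1, h2] with y hy1 hy2
    have hx : ‖r • (θ : EE n)‖ = r := by simp [norm_smul, abs_of_pos hr]
    unfold KK
    rw [hx, ← add_mul]
    have p1 : ‖y‖ ≠ 0 := norm_ne_zero_iff.2 hy1
    have p2 : ‖r • (θ : EE n) - y‖ ≠ 0 := norm_ne_zero_iff.2 (sub_ne_zero.2 hy2.symm)
    have p3 : max r ‖y‖ ≠ 0 := (lt_max_of_lt_left hr).ne'
    rw [Real.log_div p1 p2, Real.log_div p1 p3, Real.log_div p3 p2]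
    ring
  have hKi : ∀ᵐ θ : Metric.sphere (0 : EE n) 1 ∂((volume : Measure (EE n)).toSphere),
      Integrable (fun y => KK (r • (θ : EE n)) y * f y) := by
    filter_upwards [hae] with θ hθ
    refine hθ.2.mono
      (((KK_meas r).comp measurable_prodMk_left).mul hfm).aestronglyMeasurable ?_
    refine Eventually.of_forall fun y => ?_
    simp [abs_mul, mul_comm]
  by_cases hH : Integrable (fun y : EE n => Real.log (‖y‖ / max r ‖y‖) * f y)
  · refine ⟨a * (∫ y, Real.log (‖y‖ / max r ‖y‖) * f y) + C, ?_⟩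
    filter_upwards [hKi] with θ hθ
    rw [integral_congr_ae (hpt θ), integral_add hH hθ]
    have e : a * ((∫ y, Real.log (‖y‖ / max r ‖y‖) * f y) + ∫ y, KK (r • (θ : EE n)) y * f y) + C -
        (a * (∫ y, Real.log (‖y‖ / max r ‖y‖) * f y) + C) =
        a * ∫ y, KK (r • (θ : EE n)) y * f y := by ring
    rw [e, abs_mul, abs_of_pos ha]
    gcongr
    refine (abs_integral_le_integral_abs).trans (le_of_eq ?_)
    congr 1
    ext y
    rw [abs_mul, mul_comm]
  · refine ⟨C, ?_⟩
    filter_upwards [hKi] with θ hθ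
    rw [integral_undef, mul_zero, zero_add, sub_self, abs_zero]
    · exact mul_nonneg ha.le (integral_nonneg fun y => by positivity)
    · intro hc
      apply hH
      have := (hc.congr (hpt θ)).sub hθ
      refine this.congr (Eventually.of_forall fun y => ?_)
      simp

lemma ratio_bound {X : Type*} [MeasurableSpace X] (σ : Measure X) [IsFiniteMeasure σ]
    (hσ : 0 < σ.real Set.univ) (k : ℝ) (hk : 0 < k) (v W : X → ℝ) (h δ : ℝ) (hδ : 0 < δ)
    (hv : AEStronglyMeasurable v σ) (hvW : ∀ᵐ x ∂σ, |v x - h| ≤ W x)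
    (hW : ∫⁻ x, ENNReal.ofReal (Real.exp (k * W x)) ∂σ ≤
      ENNReal.ofReal ((1 + δ) * σ.real Set.univ)) :
    |(∫ x, Real.exp (k * v x) ∂σ) / σ.real Set.univ /
      Real.exp (k * ((∫ x, v x ∂σ) / σ.real Set.univ)) - 1| ≤ (1 + δ) * Real.exp δ - 1 := by
  set ω := σ.real Set.univ with hω
  have hvm : AEStronglyMeasurable (fun x => v x - h) σ := hv.sub aestronglyMeasurable_const
  have hem : AEStronglyMeasurable (fun x => Real.exp (k * |v x - h|)) σ :=
    (Real.measurable_exp.comp_aemeasurable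
      ((hvm.aemeasurable.abs).const_mul k)).aestronglyMeasurable
  have hlin : ∫⁻ x, ENNReal.ofReal (Real.exp (k * |v x - h|)) ∂σ ≤
      ENNReal.ofReal ((1 + δ) * ω) := by
    refine (lintegral_mono_ae ?_).trans hW
    filter_upwards [hvW] with x hx
    gcongr
  have hint : Integrable (fun x => Real.exp (k * |v x - h|)) σ := by
    refine ⟨hem, ?_⟩
    rw [hasFiniteIntegral_iff_ofReal (Eventually.of_forall fun y => by positivity)]
    exact hlin.trans_lt ENNReal.ofReal_lt_top
  have hle : ∫ x, Real.exp (k * |v x - h|) ∂σ ≤ (1 + δ) * ω := by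
    rw [← ofReal_integral_eq_lintegral_ofReal hint (Eventually.of_forall fun y => by positivity),
      ENNReal.ofReal_le_ofReal_iff (by positivity)] at hlin
    exact hlin
  have hle' : ∫ x, (Real.exp (k * |v x - h|) - 1) ∂σ ≤ δ * ω := by
    rw [integral_sub hint (integrable_const _), integral_const, smul_eq_mul, mul_one, ← hω]
    linarith
  have hint' : Integrable (fun x => Real.exp (k * |v x - h|) - 1) σ :=
    hint.sub (integrable_const _)
  -- the linear part
  have hi1 : Integrable (fun x => k * (v x - h)) σ := by
    refine hint'.mono' (hvm.const_mul k) (Eventually.of_forall fun x => ?_)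
    rw [norm_mul, Real.norm_of_nonneg hk.le, Real.norm_eq_abs]
    linarith [Real.add_one_le_exp (k * |v x - h|)]
  have hb1 : |∫ x, k * (v x - h) ∂σ| ≤ δ * ω := by
    rw [← Real.norm_eq_abs]
    refine (norm_integral_le_of_norm_le hint' (Eventually.of_forall fun x => ?_)).trans hle'
    rw [norm_mul, Real.norm_of_nonneg hk.le, Real.norm_eq_abs]
    linarith [Real.add_one_le_exp (k * |v x - h|)]
  have hi2 : Integrable (fun x => Real.exp (k * (v x - h))) σ := by
    refine hint.mono' (Real.measurable_exp.comp_aemeasurable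
      (hvm.aemeasurable.const_mul k)).aestronglyMeasurable (Eventually.of_forall fun x => ?_)
    rw [Real.norm_of_nonneg (by positivity)]
    gcongr
    exact le_abs_self _
  have hb2 : |∫ x, (Real.exp (k * (v x - h)) - 1) ∂σ| ≤ δ * ω := by
    rw [← Real.norm_eq_abs]
    refine (norm_integral_le_of_norm_le hint' (Eventually.of_forall fun x => ?_)).trans hle'
    have := abs_exp_sub_one_le_aux (k * (v x - h))
    rw [abs_mul, abs_of_pos hk] at this
    exact this
  rw [integral_sub hi2 (integrable_const _), integral_const, smul_eq_mul, mul_one, ← hω] at hb2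
  have hvi : Integrable v σ := by
    have h1 := (hi1.const_mul k⁻¹).add (integrable_const h)
    refine h1.congr (Eventually.of_forall fun x => ?_)
    simp only [Pi.add_apply]
    field_simp
    ring
  rw [integral_const_mul, integral_sub hvi (integrable_const _), integral_const, smul_eq_mul, ← hω]
    at hb1
  set A := ∫ x, Real.exp (k * (v x - h)) ∂σ with hA
  set V := ∫ x, v x ∂σ with hV
  have e1 : ∫ x, Real.exp (k * v x) ∂σ = Real.exp (k * h) * A := by
    rw [hA, ← integral_const_mul]
    congr 1
    ext x
    rw [← Real.exp_add]
    congr 1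
    ring
  set β := k * (V / ω - h) with hβ
  have e2 : Real.exp (k * (V / ω)) = Real.exp (k * h) * Real.exp β := by
    rw [← Real.exp_add]
    congr 1
    rw [hβ]
    ring
  have e3 : Real.exp (k * h) * A / ω / Real.exp (k * (V / ω)) = (A / ω) * Real.exp (-β) := by
    rw [e2, Real.exp_neg]
    have := (Real.exp_pos (k * h)).ne'
    field_simp
  rw [e1, e3]
  have b1 : |β| ≤ δ := by
    have : β = k * (V - ω * h) / ω := by rw [hβ]; field_simp
    rw [this, abs_div, abs_of_pos hσ, div_le_iff₀ hσ]
    exact hb1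
  have b2 : |A / ω - 1| ≤ δ := by
    rw [div_sub_one hσ.ne', abs_div, abs_of_pos hσ, div_le_iff₀ hσ]
    exact hb2
  have b3 : |Real.exp (-β) - 1| ≤ Real.exp δ - 1 := by
    refine (abs_exp_sub_one_le_aux (-β)).trans ?_
    rw [abs_neg]
    gcongr
  have b4 : A / ω * Real.exp (-β) - 1 =
      (A / ω - 1) * (Real.exp (-β) - 1) + (A / ω - 1) + (Real.exp (-β) - 1) := by ring
  rw [b4]
  calc _ ≤ |(A / ω - 1) * (Real.exp (-β) - 1)| + |A / ω - 1| + |Real.exp (-β) - 1| :=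
        abs_add_three _ _ _
    _ ≤ δ * (Real.exp δ - 1) + δ + (Real.exp δ - 1) := by
        rw [abs_mul]
        gcongr
    _ = _ := by ring

/-- For a normal metric, the spherical average of `e^{ku}` is asymptotic to `e^{k ū(r)}`:
their ratio tends to `1` as `r → ∞`. -/
theorem stmt11 (m n : ℕ) (hm : 2 ≤ m) (hn : n = 2 * m)
    (u f : EuclideanSpace ℝ (Fin n) → ℝ) (hf : MeasureTheory.Integrable f) (C : ℝ)
    (hnormal : ∀ x, u x = (1 / cconst n) * (∫ y, Real.log (‖y‖ / ‖x - y‖) * f y) + C) :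
    ∀ k > (0 : ℝ),
      Filter.Tendsto
        (fun r : ℝ =>
          sphereAvg n (fun y => Real.exp (k * u y)) r / Real.exp (k * sphereAvg n u r))
        Filter.atTop (nhds 1) := by
  intro k hk
  have hn4 : 4 ≤ n := by omega
  have hne : Nonempty (Fin n) := ⟨⟨0, by omega⟩⟩
  have ha : 0 < 1 / cconst n := by unfold cconst; positivity
  set a := 1 / cconst n with ha_def
  -- replace `f` by a measurable representative
  obtain ⟨g, hgm, hfg⟩ : ∃ g : EE n → ℝ, Measurable g ∧ f =ᵐ[volume] g :=
    ⟨hf.1.mk f, hf.1.stronglyMeasurable_mk.measurable, hf.1.ae_eq_mk⟩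
  have hg : Integrable g := hf.congr hfg
  have hu : ∀ x, u x = a * (∫ y, Real.log (‖y‖ / ‖x - y‖) * g y) + C := by
    intro x
    rw [hnormal x]
    congr 2
    refine integral_congr_ae ?_
    filter_upwards [hfg] with y hy
    rw [hy]
  have hum : StronglyMeasurable u := by
    have h1 : Measurable (fun p : EE n × EE n => Real.log (‖p.2‖ / ‖p.1 - p.2‖) * g p.2) := by
      fun_prop
    have h2 := h1.stronglyMeasurable.integral_prod_right' (ν := (volume : Measure (EE n)))
    have h3 : u = fun x => a * (∫ y, Real.log (‖y‖ / ‖x - y‖) * g y) + C := funext hu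
    rw [h3]
    exact (h2.const_mul a).add stronglyMeasurable_const
  have hω : 0 < (volume : Measure (EE n)).toSphere.real Set.univ := by
    rw [measureReal_def]
    refine ENNReal.toReal_pos ?_ (measure_ne_top _ _)
    rw [ne_eq, Measure.measure_univ_eq_zero]
    exact Measure.toSphere_ne_zero _
  rw [Metric.tendsto_nhds]
  intro ε hε
  obtain ⟨δ, hδ, hδε⟩ : ∃ δ : ℝ, 0 < δ ∧ (1 + δ) * Real.exp δ - 1 < ε := by
    have hc : ContinuousAt (fun q : ℝ => (1 + q) * Real.exp q - 1) 0 := by fun_prop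
    have h1 : ∀ᶠ q in 𝓝 (0:ℝ), (1 + q) * Real.exp q - 1 < ε :=
      hc.eventually (gt_mem_nhds (by simpa using hε))
    obtain ⟨q, hq1, hq⟩ := ((h1.filter_mono nhdsWithin_le_nhds).and
      (self_mem_nhdsWithin (s := Set.Ioi (0:ℝ)))).exists
    exact ⟨q, hq, hq1⟩
  filter_upwards [W_bound hn4 g hgm hg (k * a) (by positivity) δ hδ, eventually_gt_atTop 0]
    with r hW hr
  obtain ⟨h, hh⟩ := rep hn4 g hgm hg a C ha r hr
  have hb := ratio_bound ((volume : Measure (EE n)).toSphere) hω k hk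
    (fun θ => u (r • (θ : EE n)))
    (fun θ => a * ∫ y, |g y| * |KK (r • (θ : EE n)) y|) h δ hδ
    (hum.comp_measurable (by fun_prop)).aestronglyMeasurable
    (by
      filter_upwards [hh] with θ hθ
      rw [hu]
      exact hθ)
    (by simpa only [mul_assoc] using hW)
  rw [Real.dist_eq]
  exact lt_of_le_of_lt hb hδε
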